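/- The coefficient of the monomial x1^4 · x2^5 · x3^4 · x4^4 · x5^3 · x6^3 · x7^3 · x8^3 · x9^3 in the polynomial P = (∏_{1 ≤ k < l ≤ 9} (x_k − x_l)) / ((x1−x9)(x5−x8)(x3−x6)(x4−x7)) equals −6. -/

import Mathlib

open MvPolynomial

/-- The four excluded pairs `{1,9}, {5,8}, {3,6}, {4,7}` (0-indexed). -/
def excludedPairs : Finset (Fin 9 × Fin 9) :=
  {(0, 8), (4, 7), (2, 5), (3, 6)}

/-- `P = ∏_{1 ≤ k < l ≤ 9, {k,l} not excluded} (x_k − x_l)`. -/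
noncomputable def P : MvPolynomial (Fin 9) ℤ :=
  ∏ p ∈ Finset.univ.filter
      (fun p : Fin 9 × Fin 9 => p.1 < p.2 ∧ p ∉ excludedPairs),
    (X p.1 - X p.2)

/-- Decoding of a base 16 number into an exponent vector. -/
noncomputable def dec (n : ℕ) : Fin 9 →₀ ℕ :=
  Finsupp.equivFunOnFinite.symm (fun i => n / 16 ^ (i : ℕ) % 16)

def shiftK (i : Fin 9) (s : ℤ) : List (ℕ × ℤ) → List (ℕ × ℤ)
  | [] => []
  | (k, c) :: t =>
    bif Nat.beq (k / 16 ^ (i : ℕ) % 16) 0 then shiftK i s t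
    else (k - 16 ^ (i : ℕ), s * c) :: shiftK i s t

def mergeK : ℕ → List (ℕ × ℤ) → List (ℕ × ℤ) → List (ℕ × ℤ)
  | 0, xs, ys => xs ++ ys
  | _ + 1, [], ys => ys
  | _ + 1, x :: xs, [] => x :: xs
  | f + 1, x :: xs, y :: ys =>
    bif Nat.beq x.1 y.1 then (x.1, x.2 + y.2) :: mergeK f xs ys
    else bif Nat.ble x.1 y.1 then x :: mergeK f xs (y :: ys)
    else y :: mergeK f (x :: xs) ys

/-- Number of factors of `L` which involve the variable `i`. -/
def cntK (i : Fin 9) : List (Fin 9 × Fin 9) → ℕ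
  | [] => 0
  | e :: L => (bif Nat.beq i.val e.1.val || Nat.beq i.val e.2.val then 1 else 0) + cntK i L

/-- Drop the exponents whose `i`-th entry exceeds `n`. -/
def pruneK (i : Fin 9) (n : ℕ) : List (ℕ × ℤ) → List (ℕ × ℤ)
  | [] => []
  | x :: t =>
    bif Nat.ble (x.1 / 16 ^ (i : ℕ) % 16) n then x :: pruneK i n t else pruneK i n t

def runK : List (Fin 9 × Fin 9) → List (ℕ × ℤ) → List (ℕ × ℤ)
  | [], S => S
  | e :: L, S => runK L (pruneK e.1 (cntK e.1 L) (pruneK e.2 (cntK e.2 L)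
      (mergeK 1000 (shiftK e.1 1 S) (shiftK e.2 (-1) S))))

noncomputable def evK (p : MvPolynomial (Fin 9) ℤ) : List (ℕ × ℤ) → ℤ
  | [] => 0
  | x :: t => x.2 * coeff (dec x.1) p + evK p t

theorem digit_sub (k i j : ℕ) (h : k / 16 ^ i % 16 ≠ 0) :
    (k - 16 ^ i) / 16 ^ j % 16 = k / 16 ^ j % 16 - if i = j then 1 else 0 := by
  have hq : (k - 16 ^ i) / 16 ^ i = k / 16 ^ i - 1 := by
    simpa using Nat.sub_mul_div k (16 ^ i) 1
  have hk : 16 ^ i ≤ k := by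
    by_contra hc
    rw [Nat.div_eq_of_lt (not_le.1 hc)] at h
    simp at h
  rcases lt_trichotomy i j with hij | hij | hij
  · obtain ⟨d, rfl⟩ : ∃ d, j = i + 1 + d := ⟨j - (i + 1), by omega⟩
    rw [if_neg (by omega), pow_add, pow_succ, ← Nat.div_div_eq_div_mul,
      ← Nat.div_div_eq_div_mul, ← Nat.div_div_eq_div_mul, ← Nat.div_div_eq_div_mul, hq]
    have : (k / 16 ^ i - 1) / 16 = k / 16 ^ i / 16 := by
      clear hq
      generalize k / 16 ^ i = q at h ⊢
      omega
    rw [this, Nat.sub_zero]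
  · subst hij
    rw [if_pos rfl, hq]
    clear hq
    generalize k / 16 ^ i = q at h ⊢
    omega
  · obtain ⟨d, rfl⟩ : ∃ d, i = j + 1 + d := ⟨i - (j + 1), by omega⟩
    have e : 16 ^ (j + 1 + d) = 16 ^ j * (16 * 16 ^ d) := by ring
    rw [if_neg (by omega), e, Nat.sub_mul_div]
    have h3 : 16 * 16 ^ d ≤ k / 16 ^ j := by
      rw [Nat.le_div_iff_mul_le (by positivity), mul_comm, ← e]
      exact hk
    omega

theorem dec_sub (k : ℕ) (i : Fin 9) (h : k / 16 ^ (i : ℕ) % 16 ≠ 0) :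
    dec (k - 16 ^ (i : ℕ)) = dec k - Finsupp.single i 1 := by
  ext j
  simp only [dec, Finsupp.tsub_apply, Finsupp.equivFunOnFinite_symm_apply_apply,
    Finsupp.single_apply, digit_sub k i j h, Fin.ext_iff]

theorem coeff_X_step (k : ℕ) (i : Fin 9) (p : MvPolynomial (Fin 9) ℤ) :
    coeff (dec k) (p * X i) =
      if k / 16 ^ (i : ℕ) % 16 = 0 then 0 else coeff (dec (k - 16 ^ (i : ℕ))) p := by
  rw [coeff_mul_X']
  by_cases h : k / 16 ^ (i : ℕ) % 16 = 0
  · rw [if_pos h, if_neg]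
    simpa [dec] using h
  · rw [if_neg h, if_pos, dec_sub k i h]
    simpa [dec] using h

theorem evK_append (p : MvPolynomial (Fin 9) ℤ) (xs ys : List (ℕ × ℤ)) :
    evK p (xs ++ ys) = evK p xs + evK p ys := by
  induction xs with
  | nil => simp [evK]
  | cons x t ih => simp [evK, ih, add_assoc]

theorem evK_merge (p : MvPolynomial (Fin 9) ℤ) (f : ℕ) (xs ys : List (ℕ × ℤ)) :
    evK p (mergeK f xs ys) = evK p xs + evK p ys := by
  induction f generalizing xs ys with
  | zero => simp [mergeK, evK_append]
  | succ f ih =>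
    cases xs with
    | nil => simp [mergeK, evK]
    | cons x xs =>
      cases ys with
      | nil => simp [mergeK, evK]
      | cons y ys =>
        rw [mergeK]
        cases h : Nat.beq x.1 y.1
        · cases h2 : Nat.ble x.1 y.1
          · simp only [cond_false, evK, ih]; ring
          · simp only [cond_false, cond_true, evK, ih]; ring
        · have := Nat.eq_of_beq_eq_true h
          simp only [cond_true, evK, ih, this]; ring

theorem evK_shift (p : MvPolynomial (Fin 9) ℤ) (i : Fin 9) (s : ℤ) (S : List (ℕ × ℤ)) :
    evK p (shiftK i s S) = s * evK (p * X i) S := by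
  induction S with
  | nil => simp [shiftK, evK]
  | cons x t ih =>
    obtain ⟨k, c⟩ := x
    rw [shiftK, evK, coeff_X_step]
    cases h : Nat.beq (k / 16 ^ (i : ℕ) % 16) 0
    · have := Nat.ne_of_beq_eq_false h
      simp only [cond_false, evK, ih, if_neg this]; ring
    · have := Nat.eq_of_beq_eq_true h
      simp only [cond_true, ih, if_pos this]; ring

theorem evK_sub (p q : MvPolynomial (Fin 9) ℤ) (S : List (ℕ × ℤ)) :
    evK (p - q) S = evK p S - evK q S := by
  induction S with
  | nil => simp [evK]
  | cons x t ih => simp only [evK, ih, coeff_sub]; ring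

theorem degree_le (i : Fin 9) (L : List (Fin 9 × Fin 9)) :
    degreeOf i (L.map (fun p => (X p.1 - X p.2 : MvPolynomial (Fin 9) ℤ))).prod ≤ cntK i L := by
  induction L with
  | nil => simp [cntK]
  | cons e L ih =>
    rw [List.map_cons, List.prod_cons, cntK]
    refine (degreeOf_mul_le _ _ _).trans (add_le_add ?_ ih)
    refine (degreeOf_sub_le _ _ _).trans ?_
    rw [degreeOf_X, degreeOf_X]
    by_cases h1 : i = e.1 <;> by_cases h2 : i = e.2 <;> simp [h1, h2] <;>
      split_ifs <;> simp

theorem coeff_zero_of_cnt (i : Fin 9) (L : List (Fin 9 × Fin 9)) (k : ℕ)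
    (h : cntK i L < k / 16 ^ (i : ℕ) % 16) :
    coeff (dec k) (L.map (fun p => (X p.1 - X p.2 : MvPolynomial (Fin 9) ℤ))).prod = 0 := by
  by_contra hc
  have h1 := monomial_le_degreeOf i (mem_support_iff.2 hc)
  have h2 := h1.trans (degree_le i L)
  simp only [dec, Finsupp.equivFunOnFinite_symm_apply_apply] at h2
  omega

theorem evK_prune (i : Fin 9) (L : List (Fin 9 × Fin 9)) (S : List (ℕ × ℤ)) :
    evK (L.map (fun p => (X p.1 - X p.2 : MvPolynomial (Fin 9) ℤ))).prod
        (pruneK i (cntK i L) S) =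
      evK (L.map (fun p => (X p.1 - X p.2 : MvPolynomial (Fin 9) ℤ))).prod S := by
  induction S with
  | nil => simp [pruneK]
  | cons x t ih =>
    rw [pruneK]
    cases h : Nat.ble (x.1 / 16 ^ (i : ℕ) % 16) (cntK i L)
    · have h' : cntK i L < x.1 / 16 ^ (i : ℕ) % 16 := by
        by_contra hc
        rw [Nat.ble_eq_true_of_le (not_lt.1 hc)] at h
        cases h
      simp only [cond_false, ih, evK, coeff_zero_of_cnt i L x.1 h', mul_zero, zero_add]
    · simp only [cond_true, evK, ih]

theorem evK_run (L : List (Fin 9 × Fin 9)) (S : List (ℕ × ℤ)) :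
    evK (L.map (fun p => (X p.1 - X p.2 : MvPolynomial (Fin 9) ℤ))).prod S =
      evK 1 (runK L S) := by
  induction L generalizing S with
  | nil => simp [runK]
  | cons e L ih =>
    rw [runK, ← ih, evK_prune, evK_prune, evK_merge, evK_shift, evK_shift, List.map_cons, List.prod_cons, mul_comm,
      mul_sub, evK_sub]
    ring

/-- The factors, in the order in which they are processed. -/
def edgesK : List (Fin 9 × Fin 9) :=
  [(7, 8), (6, 8), (5, 8), (4, 8), (3, 8), (2, 8), (1, 8),
   (6, 7), (5, 7), (3, 7), (2, 7), (1, 7), (0, 7),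
   (5, 6), (4, 6), (2, 6), (1, 6), (0, 6),
   (4, 5), (3, 5), (1, 5), (0, 5),
   (3, 4), (2, 4), (1, 4), (0, 4),
   (2, 3), (1, 3), (0, 3), (1, 2), (0, 2), (0, 1)]

theorem P_eq : P = (edgesK.map (fun p => (X p.1 - X p.2 : MvPolynomial (Fin 9) ℤ))).prod := by
  have h : Finset.univ.filter
      (fun p : Fin 9 × Fin 9 => p.1 < p.2 ∧ p ∉ excludedPairs) = edgesK.toFinset := by
    have h2 : ∀ a b : Fin 9, (a < b ∧ (a, b) ∉ excludedPairs) ↔ (a, b) ∈ edgesK := by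
      decide +kernel
    ext ⟨a, b⟩
    simpa using h2 a b
  rw [P, h, List.prod_toFinset _ (by decide +kernel)]

theorem run_eq : runK edgesK [(0x333334454, 1)] = [(0, -6)] := by
  decide +kernel

/-- The coefficient of `x1^4 x2^5 x3^4 x4^4 x5^3 x6^3 x7^3 x8^3 x9^3` in `P` is `−6`. -/
theorem coeff_P_eq_neg_six :
    MvPolynomial.coeff (Finsupp.equivFunOnFinite.symm ![4, 5, 4, 4, 3, 3, 3, 3, 3]) P = -6 := by
  have h := evK_run edgesK [(0x333334454, 1)]
  rw [run_eq, ← P_eq] at h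
  have h0 : dec 0 = 0 := by ext i; simp [dec]
  have h1 : dec 0x333334454 =
      Finsupp.equivFunOnFinite.symm ![4, 5, 4, 4, 3, 3, 3, 3, 3] := by
    ext i
    fin_cases i <;> simp [dec]
  simpa [evK, h0, h1] using h
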